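/- For n ≥ 1 and real η_1, …, η_{2n+1}, define 𝐓_n(η_1,…,η_{2n+1}) = ∫_ℝ (∏_{j=1}^{2n+1}(1 − e^{iη_jζ}))/|ζ|^{2n+1} dζ. Then 𝐓_n equals 2((−1)^{n+1}/(2n)!) Σ_{ℓ=1}^{2n+1} Σ_{1≤m_1<⋯<m_ℓ≤2n+1} (−1)^ℓ (η_{m_1}+⋯+η_{m_ℓ})^{2n} log|η_{m_1}+⋯+η_{m_ℓ}|, where terms with η_{m_1}+⋯+η_{m_ℓ} = 0 are interpreted as 0. -/

import Mathlib

open MeasureTheory Set Filter Topology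

lemma aux_moment {ι : Type*} [DecidableEq ι] (x : ι → ℝ) (S : Finset ι) :
    ∀ p : ℕ, p < S.card → ∑ s ∈ S.powerset, (-1 : ℝ) ^ s.card * (∑ i ∈ s, x i) ^ p = 0 := by
  induction S using Finset.induction_on with
  | empty => intro p hp; simp at hp
  | insert a S ha ih =>
    intro p hp
    rw [Finset.card_insert_of_notMem ha] at hp
    rw [Finset.sum_powerset_insert ha]
    have h1 : ∀ t ∈ S.powerset, (-1 : ℝ) ^ (insert a t).card * (∑ i ∈ insert a t, x i) ^ p
        = -((-1 : ℝ) ^ t.card * (∑ i ∈ t, x i) ^ p)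
          - ∑ k ∈ Finset.range p, ((x a) ^ (p - k) * (p.choose k : ℝ)) *
            ((-1 : ℝ) ^ t.card * (∑ i ∈ t, x i) ^ k) := by
      intro t ht
      have hat : a ∉ t := fun h => ha (Finset.mem_powerset.mp ht h)
      rw [Finset.card_insert_of_notMem hat, Finset.sum_insert hat, add_comm (x a), add_pow,
        Finset.sum_range_succ, pow_succ]
      have : ∑ k ∈ Finset.range p, ((x a) ^ (p - k) * (p.choose k : ℝ)) *
            ((-1 : ℝ) ^ t.card * (∑ i ∈ t, x i) ^ k) = (-1 : ℝ) ^ t.card *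
          ∑ k ∈ Finset.range p, (∑ i ∈ t, x i) ^ k * (x a) ^ (p - k) * (p.choose k : ℝ) := by
        rw [Finset.mul_sum]
        exact Finset.sum_congr rfl fun k _ => by ring
      rw [this]
      simp
      ring
    rw [Finset.sum_congr rfl h1, Finset.sum_sub_distrib, Finset.sum_neg_distrib, Finset.sum_comm]
    have h2 : ∑ k ∈ Finset.range p, ∑ t ∈ S.powerset, ((x a) ^ (p - k) * (p.choose k : ℝ)) *
            ((-1 : ℝ) ^ t.card * (∑ i ∈ t, x i) ^ k) = 0 := by
      apply Finset.sum_eq_zero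
      intro k hk
      rw [← Finset.mul_sum, ih k (by have := Finset.mem_range.mp hk; omega), mul_zero]
    rw [h2]; ring

lemma aux_gamma (m : ℕ) {r : ℝ} (hr : 0 < r) :
    IntegrableOn (fun t : ℝ => t ^ m * Real.exp (-(t * r))) (Ioi 0) ∧
    ∫ t in Ioi (0:ℝ), t ^ m * Real.exp (-(t * r)) = m.factorial / r ^ (m + 1) := by
  constructor
  · have := integrableOn_rpow_mul_exp_neg_mul_rpow (p := 1) (s := m) (b := r)
      (by have : (0:ℝ) ≤ m := by positivity
          linarith) one_pos hr
    refine this.congr_fun (fun t ht => ?_) measurableSet_Ioi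
    simp [mul_comm]
  · have := Real.integral_rpow_mul_exp_neg_mul_Ioi (a := (m:ℝ) + 1) (r := r) (by positivity) hr
    rw [Real.Gamma_nat_eq_factorial] at this
    have e : ((1 / r) ^ ((m:ℝ) + 1) : ℝ) = (1 / r) ^ (m + 1) := by
      rw [← Real.rpow_natCast]; push_cast; rfl
    rw [e] at this
    calc _ = ∫ t in Ioi (0:ℝ), t ^ ((m:ℝ) + 1 - 1) * Real.exp (-(r * t)) := by
          refine setIntegral_congr_fun measurableSet_Ioi (fun t ht => ?_)
          simp [mul_comm]
      _ = _ := by rw [this]; simp; field_simp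

lemma aux_laplace (σ : ℝ) {t : ℝ} (ht : 0 < t) :
    Integrable (fun ζ : ℝ => Complex.exp (Complex.I * σ * ζ) * (Real.exp (-(t * |ζ|)) : ℂ)) ∧
    ∫ ζ : ℝ, Complex.exp (Complex.I * σ * ζ) * (Real.exp (-(t * |ζ|)) : ℂ)
      = ((2 * (t / (t ^ 2 + σ ^ 2)) : ℝ) : ℂ) := by
  have hp : 0 < (Complex.I * σ + t).re := by simpa using ht
  have hm : (Complex.I * σ - t).re < 0 := by simpa using ht
  have e1 : EqOn (fun ζ : ℝ => Complex.exp (Complex.I * σ * ζ) * (Real.exp (-(t * |ζ|)) : ℂ))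
      (fun ζ : ℝ => Complex.exp ((Complex.I * σ + t) * ζ)) (Iic 0) := by
    intro ζ hζ
    simp only [mem_Iic] at hζ
    simp only [abs_of_nonpos hζ, Complex.ofReal_exp]
    rw [← Complex.exp_add]
    congr 1; push_cast; ring
  have e2 : EqOn (fun ζ : ℝ => Complex.exp (Complex.I * σ * ζ) * (Real.exp (-(t * |ζ|)) : ℂ))
      (fun ζ : ℝ => Complex.exp ((Complex.I * σ - t) * ζ)) (Ioi 0) := by
    intro ζ hζ
    simp only [mem_Ioi] at hζ
    simp only [abs_of_pos hζ, Complex.ofReal_exp]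
    rw [← Complex.exp_add]
    congr 1; push_cast; ring
  have i1 := (integrableOn_exp_mul_complex_Iic hp 0).congr_fun e1.symm measurableSet_Iic
  have i2 := (integrableOn_exp_mul_complex_Ioi hm 0).congr_fun e2.symm measurableSet_Ioi
  constructor
  · rw [← integrableOn_univ, ← Iic_union_Ioi (a := (0:ℝ))]
    exact i1.union i2
  · rw [← intervalIntegral.integral_Iic_add_Ioi i1 i2, setIntegral_congr_fun measurableSet_Iic e1,
      setIntegral_congr_fun measurableSet_Ioi e2, integral_exp_mul_complex_Iic hp,
      integral_exp_mul_complex_Ioi hm]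
    have h1 : Complex.I * σ + t ≠ 0 := fun h => by rw [h] at hp; simp at hp
    have h2 : Complex.I * σ - t ≠ 0 := fun h => by rw [h] at hm; simp at hm
    have h3 : ((t:ℂ) ^ 2 + σ ^ 2) ≠ 0 := by
      have : t ^ 2 + σ ^ 2 ≠ 0 := by positivity
      exact_mod_cast this
    have h4 : (t:ℂ) ^ 2 + σ ^ 2 = -((Complex.I * σ + t) * (Complex.I * σ - t)) := by
      linear_combination (σ:ℂ)^2 * Complex.I_sq
    push_cast
    rw [h4]
    simp only [Complex.ofReal_zero, mul_zero, Complex.exp_zero]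
    field_simp
    ring

lemma aux_expand {ι : Type*} [Fintype ι] (η : ι → ℝ) (ζ : ℝ) :
    ∏ j, (1 - Complex.exp (Complex.I * η j * ζ)) =
    ∑ s ∈ (Finset.univ : Finset ι).powerset, (((-1 : ℝ) ^ s.card : ℝ) : ℂ) *
      Complex.exp (Complex.I * ((∑ i ∈ s, η i : ℝ) : ℂ) * ζ) := by
  simp only [sub_eq_add_neg]
  rw [Finset.prod_one_add]
  refine Finset.sum_congr rfl fun s _ => ?_
  rw [Finset.prod_neg, ← Complex.exp_sum]
  push_cast
  rw [Finset.mul_sum, Finset.sum_mul]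

lemma aux_alg {α : Type*} (P : Finset α) (c σ : α → ℝ) (n : ℕ)
    (h : ∀ k < n, ∑ s ∈ P, c s * σ s ^ (2 * k) = 0) {t : ℝ} (ht : 0 < t) :
    ∀ j ≤ n, ∑ s ∈ P, c s * (t ^ (2 * n) * (t / (t ^ 2 + σ s ^ 2))) =
      (-1) ^ j * ∑ s ∈ P, c s * (σ s ^ (2 * j) * (t ^ (2 * (n - j)) * (t / (t ^ 2 + σ s ^ 2)))) := by
  intro j
  induction j with
  | zero => simp
  | succ j ih =>
    intro hj
    rw [ih (by omega)]
    obtain ⟨d, rfl⟩ : ∃ d, n = j + 1 + d := ⟨n - (j+1), by omega⟩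
    have e1 : j + 1 + d - j = d + 1 := by omega
    have e2 : j + 1 + d - (j + 1) = d := by omega
    rw [e1, e2]
    have : ∀ s ∈ P, c s * (σ s ^ (2 * j) * (t ^ (2 * (d + 1)) * (t / (t ^ 2 + σ s ^ 2)))) =
      t ^ (2 * d + 1) * (c s * σ s ^ (2 * j)) -
      c s * (σ s ^ (2 * (j + 1)) * (t ^ (2 * d) * (t / (t ^ 2 + σ s ^ 2)))) := by
      intro s _
      have : t ^ 2 + σ s ^ 2 ≠ 0 := by positivity
      field_simp
      ring
    rw [Finset.sum_congr rfl this, Finset.sum_sub_distrib, ← Finset.mul_sum, h j (by omega)]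
    ring

lemma aux_log {α : Type*} (P : Finset α) (b σ : α → ℝ) (h0 : ∑ s ∈ P, b s = 0)
    (hz : ∀ s ∈ P, σ s = 0 → b s = 0)
    (hi : IntegrableOn (fun t : ℝ => ∑ s ∈ P, b s * (t / (t ^ 2 + σ s ^ 2))) (Ioi 0)) :
    ∫ t in Ioi (0:ℝ), ∑ s ∈ P, b s * (t / (t ^ 2 + σ s ^ 2)) =
      - ∑ s ∈ P, b s * Real.log |σ s| := by
  set G : ℝ → ℝ := fun t => ∑ s ∈ P, b s * (1 / 2 * Real.log (t ^ 2 + σ s ^ 2)) with hG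
  have hlim : Tendsto G atTop (𝓝 0) := by
    have h1 : Tendsto (fun t : ℝ => ∑ s ∈ P, b s * (1 / 2 * Real.log (1 + σ s ^ 2 * (t ^ 2)⁻¹)))
        atTop (𝓝 (∑ s ∈ P, b s * (1 / 2 * Real.log (1 + σ s ^ 2 * 0)))) := by
      refine tendsto_finsetSum _ fun s _ => ?_
      refine Tendsto.const_mul _ (Tendsto.const_mul _ ?_)
      refine Tendsto.log ?_ (by simp)
      refine Tendsto.const_add _ (Tendsto.const_mul _ ?_)
      exact tendsto_inv_atTop_zero.comp (tendsto_pow_atTop two_ne_zero)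
    simp only [mul_zero, add_zero, Real.log_one, Finset.sum_const_zero] at h1
    refine h1.congr' ?_
    filter_upwards [eventually_gt_atTop 0] with t ht
    have : ∀ s ∈ P, b s * (1 / 2 * Real.log (t ^ 2 + σ s ^ 2)) =
        b s * (1 / 2 * Real.log (t ^ 2)) + b s * (1 / 2 * Real.log (1 + σ s ^ 2 * (t ^ 2)⁻¹)) := by
      intro s _
      have e : t ^ 2 + σ s ^ 2 = t ^ 2 * (1 + σ s ^ 2 * (t ^ 2)⁻¹) := by field_simp
      rw [e, Real.log_mul (by positivity) (by positivity)]
      ring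
    simp only [hG]
    rw [Finset.sum_congr rfl this, Finset.sum_add_distrib, ← Finset.sum_mul, h0]
    simp
  have hcont : ContinuousWithinAt G (Ici 0) 0 := by
    apply ContinuousAt.continuousWithinAt
    refine tendsto_finsetSum _ fun s hs => ?_
    by_cases h : σ s = 0
    · rw [hz s hs h]; simp
    · have : ContinuousAt (fun t : ℝ => b s * (1 / 2 * Real.log (t ^ 2 + σ s ^ 2))) 0 := by
        have : (0:ℝ) ^ 2 + σ s ^ 2 ≠ 0 := by positivity
        fun_prop (disch := assumption)
      exact this
  have hder : ∀ t ∈ Ioi (0:ℝ), HasDerivAt G (∑ s ∈ P, b s * (t / (t ^ 2 + σ s ^ 2))) t := by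
    intro t ht
    simp only [mem_Ioi] at ht
    refine HasDerivAt.fun_sum fun s _ => ?_
    have hne : t ^ 2 + σ s ^ 2 ≠ 0 := by positivity
    have := ((((hasDerivAt_pow 2 t).add_const (σ s ^ 2)).log hne).const_mul (1/2)).const_mul (b s)
    refine this.congr_deriv ?_
    push_cast
    ring
  rw [integral_Ioi_of_hasDerivAt_of_tendsto hcont hder hi hlim, zero_sub]
  congr 1
  refine Finset.sum_congr rfl fun s _ => ?_
  simp [Real.log_pow]

lemma aux_bound {N : ℕ} (hN : 2 ≤ N) (η : Fin N → ℝ) :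
    Integrable (fun ζ : ℝ => ‖∏ j, (1 - Complex.exp (Complex.I * η j * ζ))‖ / |ζ| ^ N) := by
  have hf : Continuous (fun ζ : ℝ => ∏ j, (1 - Complex.exp (Complex.I * η j * ζ))) := by fun_prop
  refine ((integrable_inv_one_add_sq.const_mul (2 * (∏ j, |η j|) + 2 * 2 ^ N))).mono'
    ((hf.norm.measurable.div (by fun_prop)).aestronglyMeasurable) (ae_of_all _ fun ζ => ?_)
  have b1 : ‖∏ j, (1 - Complex.exp (Complex.I * η j * ζ))‖ ≤ (∏ j, |η j|) * |ζ| ^ N := by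
    rw [norm_prod]
    calc _ ≤ ∏ j : Fin N, (|η j| * |ζ|) := by
          refine Finset.prod_le_prod (fun _ _ => norm_nonneg _) fun j _ => ?_
          have := Real.norm_exp_I_mul_ofReal_sub_one_le (x := η j * ζ)
          rw [norm_sub_rev] at this
          simpa [abs_mul, mul_assoc] using this
      _ = _ := by rw [Finset.prod_mul_distrib]; simp
  have b2 : ‖∏ j, (1 - Complex.exp (Complex.I * η j * ζ))‖ ≤ 2 ^ N := by
    rw [norm_prod]
    calc _ ≤ ∏ j : Fin N, (2:ℝ) := by
          refine Finset.prod_le_prod (fun _ _ => norm_nonneg _) fun j _ => ?_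
          refine (norm_sub_le _ _).trans ?_
          have : ‖Complex.exp (Complex.I * η j * ζ)‖ = 1 := by
            simp [Complex.norm_exp]
          rw [this]; norm_num
      _ = _ := by simp
  have hA : 0 ≤ ∏ j, |η j| := by positivity
  set A := ∏ j, |η j|
  set B := ‖∏ j, (1 - Complex.exp (Complex.I * η j * ζ))‖
  have hB : 0 ≤ B := norm_nonneg _
  rw [Real.norm_of_nonneg (by positivity), ← div_eq_mul_inv]
  by_cases h1 : |ζ| ≤ 1
  · have hz2 : ζ ^ 2 ≤ 1 := by rw [← sq_abs]; exact pow_le_one₀ (abs_nonneg _) h1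
    have : B / |ζ| ^ N ≤ A := div_le_of_le_mul₀ (by positivity) hA b1
    refine this.trans ?_
    rw [le_div_iff₀ (by positivity)]
    have : (0:ℝ) ≤ 2 ^ N := by positivity
    nlinarith
  · push Not at h1
    have hz2 : ζ ^ 2 ≤ |ζ| ^ N := by rw [← sq_abs]; exact pow_le_pow_right₀ h1.le hN
    have hz3 : 1 < ζ ^ 2 := by rw [← sq_abs]; exact one_lt_pow₀ h1 two_ne_zero
    rw [div_le_div_iff₀ (by positivity) (by positivity)]
    have : (0:ℝ) < 2 ^ N := by positivity
    calc B * (1 + ζ ^ 2) ≤ 2 ^ N * (2 * |ζ| ^ N) := by gcongr; linarith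
      _ ≤ _ := by nlinarith [mul_nonneg hA (pow_nonneg (abs_nonneg ζ) N)]

theorem stmt12 (n : ℕ) (hn : 1 ≤ n) (η : Fin (2 * n + 1) → ℝ) :
    (∫ ζ : ℝ, (∏ j, (1 - Complex.exp (Complex.I * η j * ζ))) / ((|ζ| : ℝ) : ℂ) ^ (2 * n + 1))
      = ((2 * (-1 : ℝ) ^ (n + 1) / (Nat.factorial (2 * n)) *
          ∑ s ∈ Finset.univ.powerset.filter
              (fun s : Finset (Fin (2 * n + 1)) => s.Nonempty),
            (-1 : ℝ) ^ s.card * (∑ i ∈ s, η i) ^ (2 * n) *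
              Real.log |∑ i ∈ s, η i| : ℝ) : ℂ) := by
  set P := (Finset.univ : Finset (Fin (2 * n + 1))).powerset with hP
  set c : Finset (Fin (2 * n + 1)) → ℝ := fun s => (-1 : ℝ) ^ s.card with hc
  set σ : Finset (Fin (2 * n + 1)) → ℝ := fun s => ∑ i ∈ s, η i with hσ
  set f : ℝ → ℂ := fun ζ => ∏ j, (1 - Complex.exp (Complex.I * η j * ζ)) with hf
  have hfc : Continuous f := by simp only [hf]; fun_prop
  have hmom : ∀ p, p < 2 * n + 1 → ∑ s ∈ P, c s * σ s ^ p = 0 := fun p hp =>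
    aux_moment η Finset.univ p (by simpa using hp)
  have hfac : ((2 * n).factorial : ℝ) ≠ 0 := by positivity
  have hne : ∀ᵐ ζ : ℝ, ζ ≠ 0 := by
    simp [ae_iff]
  -- the two-variable kernel
  set F : ℝ → ℝ → ℂ := fun ζ t => f ζ * ((t ^ (2 * n) * Real.exp (-(t * |ζ|)) : ℝ) : ℂ) with hF
  have hFc : Continuous (Function.uncurry F) := by
    simp only [hF, Function.uncurry_def]
    fun_prop
  have hFint : Integrable (Function.uncurry F) (volume.prod (volume.restrict (Ioi (0:ℝ)))) := by
    rw [integrable_prod_iff hFc.aestronglyMeasurable]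
    constructor
    · filter_upwards [hne] with ζ hζ
      exact ((aux_gamma (2 * n) (abs_pos.mpr hζ)).1.ofReal (𝕜 := ℂ)).const_mul (f ζ)
    · refine ((aux_bound (by omega) η).const_mul ((2 * n).factorial : ℝ)).congr ?_
      filter_upwards [hne] with ζ hζ
      have : ∀ t ∈ Ioi (0:ℝ), ‖Function.uncurry F (ζ, t)‖ =
          ‖f ζ‖ * (t ^ (2 * n) * Real.exp (-(t * |ζ|))) := by
        intro t ht
        simp only [mem_Ioi] at ht
        simp only [Function.uncurry, hF, norm_mul, Complex.norm_real]
        rw [Real.norm_of_nonneg (by positivity), Real.norm_of_nonneg (by positivity)]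
      rw [setIntegral_congr_fun measurableSet_Ioi this, integral_const_mul,
        (aux_gamma (2 * n) (abs_pos.mpr hζ)).2]
      ring
  have hinner : ∀ t ∈ Ioi (0:ℝ), ∫ ζ, F ζ t =
      ((2 * (-1) ^ n * ∑ s ∈ P, (c s * σ s ^ (2 * n)) * (t / (t ^ 2 + σ s ^ 2)) : ℝ) : ℂ) := by
    intro t ht
    simp only [mem_Ioi] at ht
    have e : ∀ ζ, F ζ t = ∑ s ∈ P, ((c s * t ^ (2 * n) : ℝ) : ℂ) *
        (Complex.exp (Complex.I * (σ s : ℂ) * ζ) * (Real.exp (-(t * |ζ|)) : ℂ)) := by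
      intro ζ
      simp only [hF, hf]
      rw [aux_expand, Finset.sum_mul]
      refine Finset.sum_congr rfl fun s _ => ?_
      simp only [hc, hσ]
      push_cast
      ring
    simp only [e]
    rw [integral_finsetSum _ fun s _ => (aux_laplace (σ s) ht).1.const_mul _]
    simp only [integral_const_mul, (aux_laplace _ ht).2]
    have := aux_alg P c σ n (fun k hk => hmom (2 * k) (by omega)) ht n le_rfl
    simp only [Nat.sub_self, mul_zero, pow_zero, one_mul] at this
    simp only [mul_assoc]
    rw [← this]
    norm_cast
    rw [Finset.mul_sum]
    exact Finset.sum_congr rfl fun s _ => by ring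
  have hJ : IntegrableOn (fun t : ℝ => ∑ s ∈ P, (c s * σ s ^ (2 * n)) * (t / (t ^ 2 + σ s ^ 2)))
      (Ioi 0) := by
    have h1 : IntegrableOn (fun t => ∫ ζ, F ζ t) (Ioi 0) := hFint.integral_prod_right
    have h2 := (h1.congr_fun hinner measurableSet_Ioi).re
    simp only [RCLike.re_to_complex, Complex.ofReal_re] at h2
    have h3 := h2.const_mul ((2 * (-1) ^ n)⁻¹ : ℝ)
    refine h3.congr (ae_of_all _ fun t => ?_)
    have : (2 * (-1) ^ n : ℝ) ≠ 0 := by simp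
    exact inv_mul_cancel_left₀ this _
  have hlog := aux_log P (fun s => c s * σ s ^ (2 * n)) σ (hmom _ (by omega))
    (fun s _ h => by simp [h]; omega) hJ
  have hswap := integral_integral_swap hFint
  have hL : ∫ ζ : ℝ, ∫ t in Ioi (0:ℝ), F ζ t =
      ((2 * n).factorial : ℂ) * ∫ ζ : ℝ, f ζ / ((|ζ| : ℝ) : ℂ) ^ (2 * n + 1) := by
    rw [← integral_const_mul]
    refine integral_congr_ae ?_
    filter_upwards [hne] with ζ hζ
    simp only [hF]
    rw [integral_const_mul, integral_complex_ofReal, (aux_gamma (2 * n) (abs_pos.mpr hζ)).2]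
    push_cast
    ring
  have hR : ∫ t in Ioi (0:ℝ), ∫ ζ : ℝ, F ζ t =
      ((2 * (-1) ^ n * - ∑ s ∈ P, c s * σ s ^ (2 * n) * Real.log |σ s| : ℝ) : ℂ) := by
    rw [setIntegral_congr_fun measurableSet_Ioi hinner, integral_complex_ofReal,
      integral_const_mul, hlog]
  have hsum : ∑ s ∈ P.filter (fun s => s.Nonempty), c s * σ s ^ (2 * n) * Real.log |σ s| =
      ∑ s ∈ P, c s * σ s ^ (2 * n) * Real.log |σ s| := by
    refine Finset.sum_filter_of_ne fun s _ h => ?_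
    by_contra hs
    rw [Finset.not_nonempty_iff_eq_empty] at hs
    apply h
    simp [hs, hσ]
  have hfac' : ((2 * n).factorial : ℂ) ≠ 0 := by exact_mod_cast hfac
  apply mul_left_cancel₀ hfac'
  rw [← hL, hswap, hR, hsum, ← Complex.ofReal_natCast, ← Complex.ofReal_mul]
  congr 1
  field_simp
  ring
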